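/- There exists a distinct covering system with least modulus 5 whose moduli have least common multiple equal to 2^4·3^2·5^2 = 3600 and which contains no congruence with modulus 25, 100, 300, or 900. -/

import Mathlib

/-- The congruences `x ≡ r (mod n)` of a distinct covering system, listed as pairs `(n, r)`. -/
def coveringPairs : List (ℕ × ℕ) :=
  [(5, 0), (6, 5), (8, 2), (9, 1), (10, 8), (12, 9), (15, 9), (16, 3),
   (18, 7), (20, 16), (24, 15), (30, 14), (36, 13), (40, 6), (45, 34), (48, 27),
   (50, 2), (60, 12), (72, 31), (75, 32), (80, 22), (90, 4), (120, 32), (144, 139),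
   (150, 62), (180, 52), (200, 92), (225, 157), (240, 222), (360, 112), (400, 222), (450, 112),
   (600, 572), (720, 142), (1200, 542), (1800, 1372), (3600, 2542)]

/-- The residue that `coveringPairs` attaches to the modulus `n`. -/
def coveringResidue (n : ℕ) : ℕ := (coveringPairs.lookup n).getD 0

/-- A finite set of moduli dividing `L` covers `ℤ` as soon as it covers the residues below `L`. -/
theorem covers_int_of_covers_range {S : Finset ℕ} {r : ℕ → ℕ} {L : ℕ} (hL : 0 < L)
    (hdvd : ∀ n ∈ S, n ∣ L) (hcov : ∀ a < L, ∃ n ∈ S, a % n = r n % n) (x : ℤ) :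
    ∃ n ∈ S, x ≡ (r n : ℤ) [ZMOD (n : ℤ)] := by
  have hL' : (0 : ℤ) < L := by exact_mod_cast hL
  obtain ⟨a, ha⟩ := Int.eq_ofNat_of_zero_le (Int.emod_nonneg x hL'.ne')
  have haL : a < L := by
    have := Int.emod_lt_of_pos x hL'
    omega
  obtain ⟨n, hn, h⟩ := hcov a haL
  refine ⟨n, hn, ?_⟩
  have hxa : x ≡ (a : ℤ) [ZMOD (L : ℤ)] := ha ▸ (Int.mod_modEq x L).symm
  exact (hxa.of_dvd (Int.natCast_dvd_natCast.mpr (hdvd n hn))).trans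
    ((Int.natCast_modEq_iff).mpr h)

theorem coveringPairs_covers_range :
    ∀ a < 3600, ∃ n ∈ (coveringPairs.map Prod.fst).toFinset,
      a % n = coveringResidue n % n := by
  have h : (List.range 3600).all (fun a =>
      (coveringPairs.map Prod.fst).any fun n => a % n == coveringResidue n % n) = true := by
    decide +kernel
  simpa only [List.all_eq_true, List.any_eq_true, List.mem_range, List.mem_toFinset,
    beq_iff_eq] using h


/-- There exists a distinct covering system with least modulus 5, lcm of moduli 2^4 * 3^2 * 5^2 = 3600, containing no congruence with modulus 25, 100, 300, or 900. -/
theorem exists_covering_m5_L3600_no_25_100_300_900 :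
    ∃ (S : Finset ℕ) (r : ℕ → ℤ),
      (∀ n ∈ S, 1 < n) ∧
      (∀ x : ℤ, ∃ n ∈ S, x ≡ r n [ZMOD (n : ℤ)]) ∧
      (5 ∈ S ∧ ∀ n ∈ S, 5 ≤ n) ∧
      S.lcm id = 2 ^ 4 * 3 ^ 2 * 5 ^ 2 ∧
      25 ∉ S ∧ 100 ∉ S ∧ 300 ∉ S ∧ 900 ∉ S := by
  refine ⟨(coveringPairs.map Prod.fst).toFinset, fun n => coveringResidue n, by decide +kernel,
    covers_int_of_covers_range (L := 3600) (by norm_num) (by decide +kernel)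
      coveringPairs_covers_range,
    by decide +kernel, by decide +kernel, by decide +kernel, by decide +kernel,
    by decide +kernel, by decide +kernel⟩
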